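/- arXiv:2110.08570 — 2 statements merged into one kernel-verified Lean document; each statement's English description precedes it below -/
import Mathlib

section
/- For every fixed ρ < 0, S₂ = Σ_{j=1}^k W̃_j C_j² - (Σ_{j=1}^k W̃_j C_j)² converges to ρ²(5-ρ)/((1-2ρ)(1-ρ)²(2-ρ)²) as k → ∞. (Lemma 1(ii)) -/
open Filter Finset MeasureTheory ProbabilityTheory

/-- The weights `W_j = 1 - j/(k+1)`. -/
noncomputable def Wk (k j : ℕ) : ℝ := 1 - (j : ℝ) / ((k : ℝ) + 1)

/-- The normalized weights `W̃_j = W_j / ∑_{i=1}^k W_i`. -/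
noncomputable def Wt (k j : ℕ) : ℝ := Wk k j / ∑ i ∈ Finset.Icc 1 k, Wk k i

/-- The covariates `C_j = (j/(k+1))^{-ρ}`. -/
noncomputable def Cjk (ρ : ℝ) (k j : ℕ) : ℝ := ((j : ℝ) / ((k : ℝ) + 1)) ^ (-ρ)

/-- `S₁ = ∑_{j=1}^k W̃_j C_j`. -/
noncomputable def Sone (ρ : ℝ) (k : ℕ) : ℝ := ∑ j ∈ Finset.Icc 1 k, Wt k j * Cjk ρ k j

/-- `S₂ = ∑_{j=1}^k W̃_j C_j² - (∑_{j=1}^k W̃_j C_j)²`. -/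
noncomputable def Stwo (ρ : ℝ) (k : ℕ) : ℝ :=
  (∑ j ∈ Finset.Icc 1 k, Wt k j * (Cjk ρ k j) ^ 2) - (Sone ρ k) ^ 2

/-- Riemann sums of `x ^ a` on `[0, 1]` with mesh `1 / (k + 1)` converge to `1 / (a + 1)`. -/
theorem tendsto_riemann_sum_rpow {a : ℝ} (ha : 0 ≤ a) :
    Tendsto (fun k : ℕ => (∑ j ∈ Icc 1 k, ((j : ℝ) / ((k : ℝ) + 1)) ^ a) / ((k : ℝ) + 1))
      atTop (nhds (1 / (a + 1))) := by
  have hmono (n : ℕ) : MonotoneOn (fun x : ℝ => x ^ a) (Set.Icc 0 (0 + (n : ℝ))) :=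
    fun x hx y _ hxy => Real.rpow_le_rpow hx.1 hxy ha
  have hintegral (n : ℕ) : ∫ x in (0 : ℝ)..(0 + (n : ℝ)), x ^ a = (n : ℝ) ^ (a + 1) / (a + 1) := by
    rw [integral_rpow (Or.inl (by linarith)), Real.zero_rpow (by linarith)]
    simp
  have hupper (k : ℕ) :
      ∑ j ∈ Icc 1 k, (j : ℝ) ^ a ≤ ((k : ℝ) + 1) ^ (a + 1) / (a + 1) := by
    have h := (hmono (k + 1)).sum_le_integral
    rw [hintegral] at h
    push_cast at h
    refine le_trans (sum_le_sum_of_subset_of_nonneg ?_ ?_) (by simpa using h)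
    · intro j hj
      simp only [mem_Icc, mem_range] at *
      lia
    · intro j _ _
      positivity
  have hlower (k : ℕ) :
      ((k : ℝ) + 1) ^ (a + 1) / (a + 1) ≤ ∑ j ∈ Icc 1 k, (j : ℝ) ^ a + ((k : ℝ) + 1) ^ a := by
    have h := (hmono (k + 1)).integral_le_sum
    rw [hintegral, sum_range_succ, range_eq_Ico, sum_Ico_add' (fun i : ℕ => (0 + (i : ℝ)) ^ a)] at h
    simpa [Ico_add_one_right_eq_Icc] using h
  have heq (k : ℕ) : (∑ j ∈ Icc 1 k, ((j : ℝ) / ((k : ℝ) + 1)) ^ a) / ((k : ℝ) + 1) =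
      (∑ j ∈ Icc 1 k, (j : ℝ) ^ a) / ((k : ℝ) + 1) ^ (a + 1) := by
    have hk : (0 : ℝ) < (k : ℝ) + 1 := by positivity
    rw [Real.rpow_add_one hk.ne', ← div_div, sum_div _ _ (((k : ℝ) + 1) ^ a)]
    congr 1
    exact sum_congr rfl fun j _ => Real.div_rpow (by positivity) hk.le a
  have ha1 : 0 < a + 1 := by linarith
  refine tendsto_of_tendsto_of_tendsto_of_le_of_le
    (g := fun k : ℕ => 1 / (a + 1) - 1 / ((k : ℝ) + 1)) (h := fun _ => 1 / (a + 1))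
    ?_ tendsto_const_nhds (fun k => ?_) (fun k => ?_)
  · simpa using tendsto_const_nhds.sub (tendsto_one_div_add_atTop_nhds_zero_nat (𝕜 := ℝ))
  · have hk : (0 : ℝ) < (k : ℝ) + 1 := by positivity
    have hp : 0 < ((k : ℝ) + 1) ^ a := by positivity
    have h := hlower k
    simp only [heq]
    rw [le_div_iff₀ (by positivity)]
    have : (1 / (a + 1) - 1 / ((k : ℝ) + 1)) * ((k : ℝ) + 1) ^ (a + 1) =
        ((k : ℝ) + 1) ^ (a + 1) / (a + 1) - ((k : ℝ) + 1) ^ a := by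
      rw [Real.rpow_add_one hk.ne']
      field_simp
    linarith
  · simp only [heq]
    rw [div_le_iff₀ (by positivity), one_div_mul_eq_div]
    exact hupper k

/-- The weighted power sums with weights `Wk` are Riemann sums of `(1 - x) * x ^ a`. -/
theorem tendsto_sum_Wk_mul_rpow {a : ℝ} (ha : 0 ≤ a) :
    Tendsto (fun k : ℕ => (∑ j ∈ Icc 1 k, Wk k j * ((j : ℝ) / ((k : ℝ) + 1)) ^ a) / ((k : ℝ) + 1))
      atTop (nhds (1 / (a + 1) - 1 / (a + 1 + 1))) := by
  refine ((tendsto_riemann_sum_rpow ha).sub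
    (tendsto_riemann_sum_rpow (a := a + 1) (by linarith))).congr fun k => ?_
  rw [← sub_div, ← sum_sub_distrib]
  congr 1
  refine sum_congr rfl fun j hj => ?_
  have hj : 1 ≤ j := (mem_Icc.mp hj).1
  have hx : (j : ℝ) / ((k : ℝ) + 1) ≠ 0 := by positivity
  rw [Real.rpow_add_one hx, Wk]
  ring

/-- The `Wt`-weighted means of `x ^ a` converge to the `a`-th moment of the density `2 (1 - x)`. -/
theorem tendsto_sum_Wt_mul_rpow {a : ℝ} (ha : 0 ≤ a) :
    Tendsto (fun k : ℕ => ∑ j ∈ Icc 1 k, Wt k j * ((j : ℝ) / ((k : ℝ) + 1)) ^ a)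
      atTop (nhds (2 / ((a + 1) * (a + 2)))) := by
  have h := (tendsto_sum_Wk_mul_rpow ha).div (tendsto_sum_Wk_mul_rpow le_rfl) (by norm_num)
  have hlim : (1 / (a + 1) - 1 / (a + 1 + 1)) / (1 / ((0 : ℝ) + 1) - 1 / (0 + 1 + 1)) =
      2 / ((a + 1) * (a + 2)) := by
    have : a + 1 + 1 ≠ 0 := by linarith
    have : a + 1 ≠ 0 := by linarith
    have : a + 2 ≠ 0 := by linarith
    field_simp
    ring
  rw [hlim] at h
  refine h.congr fun k => ?_
  have hk : (k : ℝ) + 1 ≠ 0 := by positivity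
  simp only [Pi.div_apply, Real.rpow_zero, mul_one]
  rw [div_div_div_cancel_right₀ hk, sum_div]
  exact sum_congr rfl fun j _ => by rw [Wt]; ring

/-- Lemma 1(ii): For every fixed ρ < 0,
`S₂ → ρ²(5-ρ)/((1-2ρ)(1-ρ)²(2-ρ)²)` as `k → ∞`. -/
theorem Stwo_tendsto (ρ : ℝ) (hρ : ρ < 0) :
    Filter.Tendsto (fun k : ℕ => Stwo ρ k) Filter.atTop
      (nhds (ρ ^ 2 * (5 - ρ) / ((1 - 2 * ρ) * (1 - ρ) ^ 2 * (2 - ρ) ^ 2))) := by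
  have h1 := tendsto_sum_Wt_mul_rpow (a := -ρ) (by linarith)
  have h2 := tendsto_sum_Wt_mul_rpow (a := -ρ * 2) (by linarith)
  have hlim : 2 / ((-ρ * 2 + 1) * (-ρ * 2 + 2)) - (2 / ((-ρ + 1) * (-ρ + 2))) ^ 2 =
      ρ ^ 2 * (5 - ρ) / ((1 - 2 * ρ) * (1 - ρ) ^ 2 * (2 - ρ) ^ 2) := by
    have e1 : 1 - 2 * ρ ≠ 0 := by linarith
    have e2 : 1 - ρ ≠ 0 := by linarith
    have e3 : 2 - ρ ≠ 0 := by linarith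
    rw [show -ρ * 2 + 1 = 1 - 2 * ρ by ring, show -ρ * 2 + 2 = 2 * (1 - ρ) by ring,
      show -ρ + 1 = 1 - ρ by ring, show -ρ + 2 = 2 - ρ by ring]
    field_simp
    ring
  rw [← hlim]
  refine (h2.sub (h1.pow 2)).congr fun k => ?_
  rw [Stwo, Sone]
  congr 1
  refine sum_congr rfl fun j _ => ?_
  rw [Cjk, ← Real.rpow_mul_natCast (by positivity)]
  norm_num
end

section
/- For every fixed ρ < 0, Ṡ = Σ_{j=1}^k W̃_j² (S₁ - C_j) converges to 0 as k → ∞. (Lemma 1(iii)) -/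
open Filter Finset MeasureTheory ProbabilityTheory

lemma Wk_nonneg {k j : ℕ} (hj : j ≤ k) : 0 ≤ Wk k j := by
  have : (j : ℝ) ≤ k := by exact_mod_cast hj
  rw [Wk, sub_nonneg, div_le_one (by positivity)]
  linarith

lemma Wk_le_one (k j : ℕ) : Wk k j ≤ 1 :=
  sub_le_self _ (by positivity)

lemma sum_Wk (k : ℕ) : ∑ i ∈ Finset.Icc 1 k, Wk k i = (k : ℝ) / 2 := by
  have gauss (n : ℕ) : ∑ i ∈ Finset.Icc 1 n, (i : ℝ) = n * (n + 1) / 2 := by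
    induction n with
    | zero => simp
    | succ n ih =>
      rw [Finset.sum_Icc_succ_top (by omega), ih]
      push_cast
      ring
  simp only [Wk, Finset.sum_sub_distrib, ← Finset.sum_div, gauss]
  have : (k : ℝ) + 1 ≠ 0 := by positivity
  simp
  field_simp
  ring

lemma Wt_nonneg {k j : ℕ} (hj : j ≤ k) : 0 ≤ Wt k j := by
  rw [Wt, sum_Wk]
  exact div_nonneg (Wk_nonneg hj) (by positivity)

lemma Wt_le (k j : ℕ) : Wt k j ≤ 2 / k := by
  rw [Wt, sum_Wk, ← one_div_div (k : ℝ) 2]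
  exact div_le_div_of_nonneg_right (Wk_le_one k j) (by positivity)

lemma sum_Wt {k : ℕ} (hk : k ≠ 0) : ∑ j ∈ Finset.Icc 1 k, Wt k j = 1 := by
  simp only [Wt, ← Finset.sum_div]
  refine div_self ?_
  rw [sum_Wk]
  positivity

lemma Cjk_nonneg (ρ : ℝ) (k j : ℕ) : 0 ≤ Cjk ρ k j :=
  Real.rpow_nonneg (by positivity) _

lemma Cjk_le_one {ρ : ℝ} (hρ : ρ ≤ 0) {k j : ℕ} (hj : j ≤ k) : Cjk ρ k j ≤ 1 := by
  have : (0 : ℝ) ≤ 1 - (j : ℝ) / ((k : ℝ) + 1) := Wk_nonneg hj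
  exact Real.rpow_le_one (by positivity) (by linarith) (by linarith)

lemma Sone_nonneg (ρ : ℝ) (k : ℕ) : 0 ≤ Sone ρ k :=
  Finset.sum_nonneg fun j hj =>
    mul_nonneg (Wt_nonneg (Finset.mem_Icc.1 hj).2) (Cjk_nonneg ρ k j)

lemma Sone_le_one {ρ : ℝ} (hρ : ρ ≤ 0) {k : ℕ} (hk : k ≠ 0) : Sone ρ k ≤ 1 := by
  rw [← sum_Wt hk]
  refine Finset.sum_le_sum fun j hj => ?_
  have hj := (Finset.mem_Icc.1 hj).2
  exact mul_le_of_le_one_right (Wt_nonneg hj) (Cjk_le_one hρ hj)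

lemma abs_sum_sq_Wt_mul_le {ρ : ℝ} (hρ : ρ ≤ 0) {k : ℕ} (hk : k ≠ 0) :
    |∑ j ∈ Finset.Icc 1 k, (Wt k j) ^ 2 * (Sone ρ k - Cjk ρ k j)| ≤ 2 / k := by
  calc
    _ ≤ ∑ j ∈ Finset.Icc 1 k, |(Wt k j) ^ 2 * (Sone ρ k - Cjk ρ k j)| :=
      Finset.abs_sum_le_sum_abs _ _
    _ ≤ ∑ j ∈ Finset.Icc 1 k, 2 / (k : ℝ) * Wt k j := by
      refine Finset.sum_le_sum fun j hj => ?_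
      have hj := (Finset.mem_Icc.1 hj).2
      have hC : |Sone ρ k - Cjk ρ k j| ≤ 1 := by
        rw [abs_le]
        constructor <;>
          linarith [Sone_nonneg ρ k, Sone_le_one hρ hk, Cjk_nonneg ρ k j, Cjk_le_one hρ hj]
      rw [abs_mul, abs_of_nonneg (sq_nonneg _)]
      refine (mul_le_of_le_one_right (sq_nonneg _) hC).trans ?_
      rw [sq]
      exact mul_le_mul_of_nonneg_right (Wt_le k j) (Wt_nonneg hj)
    _ = 2 / k := by rw [← Finset.mul_sum, sum_Wt hk, mul_one]

/-- Lemma 1(iii): For every fixed ρ < 0,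
`Ṡ = ∑_{j=1}^k W̃_j² (S₁ - C_j) → 0` as `k → ∞`. -/
theorem Sdot_tendsto (ρ : ℝ) (hρ : ρ < 0) :
    Filter.Tendsto
      (fun k : ℕ => ∑ j ∈ Finset.Icc 1 k, (Wt k j) ^ 2 * (Sone ρ k - Cjk ρ k j))
      Filter.atTop (nhds 0) := by
  refine squeeze_zero_norm' ?_ (tendsto_const_div_atTop_nhds_zero_nat 2)
  filter_upwards [Filter.eventually_ne_atTop 0] with k hk
  exact abs_sum_sq_Wt_mul_le hρ.le hk
end
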